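/- arXiv:2505.11749 — 3 statements merged into one kernel-verified Lean document; each statement's English description precedes it below -/
import Mathlib

section
/- Let (Ω, P) be a probability space, E and F standard Borel spaces, and X, X' : Ω → E, M : Ω → F random variables. If KL(law(X', M) ‖ law(X) ⊗ law(M)) ≤ KL(law(X, M) ‖ law(X) ⊗ law(M)), then I(X'; M) ≤ I(X; M). (This is the one-step version of Proposition 1: each MIRI iteration, whose optimal imputer achieves a KL value no larger than that of the identity imputer, does not increase the mutual information between the imputed data and the missingness mask.) -/
open MeasureTheory ProbabilityTheory
open scoped ENNReal Classical

/-- The Kullback–Leibler divergence `KL(μ ‖ ν)`: equal to `∫ log (dμ/dν) dμ` if `μ ≪ ν` and the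
integral is defined, and `+∞` otherwise. -/
noncomputable def klDiv {α : Type*} [MeasurableSpace α] (μ ν : Measure α) : ℝ≥0∞ :=
  if μ ≪ ν ∧ Integrable (llr μ ν) μ then ENNReal.ofReal (∫ x, llr μ ν x ∂μ) else ⊤

/-- The mutual information `I(X; M)` between two random variables, defined as the KL divergence
between the joint law and the product of the marginal laws. -/
noncomputable def mutualInfo {Ω E F : Type*} [MeasurableSpace Ω] [MeasurableSpace E]
    [MeasurableSpace F] (P : Measure Ω) (X : Ω → E) (M : Ω → F) : ℝ≥0∞ :=
  klDiv (P.map (fun ω => (X ω, M ω))) ((P.map X).prod (P.map M))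

theorem klDiv_eq_informationTheory_klDiv {α : Type*} [MeasurableSpace α] (μ ν : Measure α)
    [IsProbabilityMeasure μ] [IsProbabilityMeasure ν] :
    klDiv μ ν = InformationTheory.klDiv μ ν := by
  simp [klDiv, InformationTheory.klDiv]

theorem klDiv_map_prodMk_eq_add_mutualInfo
    {Ω E F : Type*} [MeasurableSpace Ω] [MeasurableSpace E]
    [MeasurableSpace F] [StandardBorelSpace F] (P : Measure Ω) [IsProbabilityMeasure P]
    {X : Ω → E} {M : Ω → F} (hX : Measurable X) (hM : Measurable M)
    (ν : Measure E) [IsProbabilityMeasure ν] :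
    klDiv (P.map (fun ω => (X ω, M ω))) (ν.prod (P.map M))
      = klDiv (P.map X) ν + mutualInfo P X M := by
  have : Nonempty F := P.nonempty_of_neZero.map M
  have := Measure.isProbabilityMeasure_map (μ := P) hX.aemeasurable
  have := Measure.isProbabilityMeasure_map (μ := P) hM.aemeasurable
  have := Measure.isProbabilityMeasure_map (μ := P) (hX.prodMk hM).aemeasurable
  rw [mutualInfo, klDiv_eq_informationTheory_klDiv, klDiv_eq_informationTheory_klDiv,
    klDiv_eq_informationTheory_klDiv, ← compProd_map_condDistrib hM.aemeasurable,
    ← Measure.compProd_const, ← Measure.compProd_const]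
  exact InformationTheory.klDiv_compProd_eq_add ..

theorem mutualInfo_le_klDiv_map_prodMk
    {Ω E F : Type*} [MeasurableSpace Ω] [MeasurableSpace E]
    [MeasurableSpace F] [StandardBorelSpace F] (P : Measure Ω) [IsProbabilityMeasure P]
    {X : Ω → E} {M : Ω → F} (hX : Measurable X) (hM : Measurable M)
    (ν : Measure E) [IsProbabilityMeasure ν] :
    mutualInfo P X M ≤ klDiv (P.map (fun ω => (X ω, M ω))) (ν.prod (P.map M)) :=
  klDiv_map_prodMk_eq_add_mutualInfo P hX hM ν ▸ le_add_self

/-- One-step version of Proposition 1 (MIRI): if the KL divergence of the law of `(X', M)` from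
`law(X) ⊗ law(M)` is at most that of the law of `(X, M)`, then `I(X'; M) ≤ I(X; M)`. -/
theorem mutualInfo_le_of_klDiv_le
    {Ω E F : Type*} [MeasurableSpace Ω]
    [MeasurableSpace E] [StandardBorelSpace E] [MeasurableSpace F] [StandardBorelSpace F]
    (P : Measure Ω) [IsProbabilityMeasure P]
    (X X' : Ω → E) (M : Ω → F)
    (hX : Measurable X) (hX' : Measurable X') (hM : Measurable M)
    (h : klDiv (P.map (fun ω => (X' ω, M ω))) ((P.map X).prod (P.map M))
        ≤ klDiv (P.map (fun ω => (X ω, M ω))) ((P.map X).prod (P.map M))) :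
    mutualInfo P X' M ≤ mutualInfo P X M := by
  have := Measure.isProbabilityMeasure_map (μ := P) hX.aemeasurable
  exact (mutualInfo_le_klDiv_map_prodMk P hX' hM (P.map X)).trans h
end

section
/- Let (Ω, P) be a probability space, E and F standard Borel spaces, X : Ω → E and M : Ω → F random variables, and ν a probability measure on E. Then, as an identity in [0, ∞], KL(law(X, M) ‖ ν ⊗ law(M)) = I(X; M) + KL(law(X) ‖ ν). In particular, whenever the left-hand side is finite, law(X, M) ≪ law(X) ⊗ law(M) and law(X) ≪ ν. (This identity underlies the bound of term A in the proof of Proposition 1.) -/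
open MeasureTheory ProbabilityTheory
open scoped ENNReal Classical

/-- If `klDiv μ ν` is finite, then `μ ≪ ν`. -/
theorem absolutelyContinuous_of_klDiv_ne_top {α : Type*} [MeasurableSpace α] {μ ν : Measure α}
    (h : klDiv μ ν ≠ ⊤) : μ ≪ ν := by
  by_contra hac
  exact h (if_neg fun h' => hac h'.1)

/-- The chain-rule identity underlying the bound of term A in the proof of Proposition 1:
for any probability measure `ν` on `E`,
`KL(law(X, M) ‖ ν ⊗ law(M)) = I(X; M) + KL(law(X) ‖ ν)` as an identity in `[0, ∞]`; moreover,
if the left-hand side is finite then `law(X, M) ≪ law(X) ⊗ law(M)` and `law(X) ≪ ν`. -/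
theorem klDiv_prod_eq_mutualInfo_add_klDiv
    {Ω E F : Type*} [MeasurableSpace Ω]
    [MeasurableSpace E] [StandardBorelSpace E] [MeasurableSpace F] [StandardBorelSpace F]
    (P : Measure Ω) [IsProbabilityMeasure P]
    (X : Ω → E) (M : Ω → F) (hX : Measurable X) (hM : Measurable M)
    (ν : Measure E) [IsProbabilityMeasure ν] :
    klDiv (P.map (fun ω => (X ω, M ω))) (ν.prod (P.map M))
        = mutualInfo P X M + klDiv (P.map X) ν
      ∧ (klDiv (P.map (fun ω => (X ω, M ω))) (ν.prod (P.map M)) ≠ ⊤ →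
          (P.map (fun ω => (X ω, M ω))) ≪ (P.map X).prod (P.map M) ∧ P.map X ≪ ν) := by
  have : Nonempty F := (nonempty_of_isProbabilityMeasure P).map M
  have := Measure.isProbabilityMeasure_map (μ := P) hX.aemeasurable
  have := Measure.isProbabilityMeasure_map (μ := P) hM.aemeasurable
  have := Measure.isProbabilityMeasure_map (μ := P) (hX.prodMk hM).aemeasurable
  have key : klDiv (P.map (fun ω => (X ω, M ω))) (ν.prod (P.map M))
      = mutualInfo P X M + klDiv (P.map X) ν := by
    rw [mutualInfo]
    simp only [klDiv_eq_informationTheory_klDiv]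
    rw [← compProd_map_condDistrib hM.aemeasurable, ← Measure.compProd_const,
      ← Measure.compProd_const, InformationTheory.klDiv_compProd_eq_add, add_comm]
  refine ⟨key, fun h => ?_⟩
  rw [key, ENNReal.add_ne_top] at h
  exact ⟨absolutelyContinuous_of_klDiv_ne_top h.1, absolutelyContinuous_of_klDiv_ne_top h.2⟩
end

section
/- Let (Ω, P) be a probability space, W : Ω → α and Z : Ω → β independent random variables with values in standard Borel spaces, and g : α → γ a measurable map. Then for every bounded measurable φ : α → ℝ, the conditional expectation satisfies E[φ(W) | σ(g ∘ W) ⊔ σ(Z)] = E[φ(W) | σ(g ∘ W)] almost surely, where σ(g ∘ W) ⊔ σ(Z) denotes the σ-algebra generated jointly by g ∘ W and Z. (Conditioning on additional information that is independent of W does not change conditional expectations of functions of W; this is the conditional-expectation form of the paper's conditional independence lemma.) -/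
open MeasureTheory ProbabilityTheory
open scoped ENNReal

/-- The σ-algebra `m₁ ⊔ m₂` is generated by the intersections of an `m₁`-measurable set
with an `m₂`-measurable set. -/
theorem MeasurableSpace.generateFrom_image2_inter {Ω : Type*} (m₁ m₂ : MeasurableSpace Ω) :
    MeasurableSpace.generateFrom
      (Set.image2 (· ∩ ·) {s | MeasurableSet[m₁] s} {t | MeasurableSet[m₂] t}) = m₁ ⊔ m₂ := by
  apply le_antisymm
  · refine MeasurableSpace.generateFrom_le ?_
    rintro _ ⟨s, hs, t, ht, rfl⟩
    exact MeasurableSet.inter (le_sup_left (a := m₁) s hs) (le_sup_right (b := m₂) t ht)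
  · refine sup_le (fun s hs ↦ ?_) (fun t ht ↦ ?_)
    · exact MeasurableSpace.measurableSet_generateFrom
        ⟨s, hs, Set.univ, MeasurableSet.univ, Set.inter_univ s⟩
    · exact MeasurableSpace.measurableSet_generateFrom
        ⟨Set.univ, MeasurableSet.univ, t, ht, Set.univ_inter t⟩

theorem isPiSystem_image2_inter {Ω : Type*} {S T : Set (Set Ω)}
    (hS : IsPiSystem S) (hT : IsPiSystem T) : IsPiSystem (Set.image2 (· ∩ ·) S T) := by
  rintro _ ⟨s, hs, t, ht, rfl⟩ _ ⟨s', hs', t', ht', rfl⟩ hne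
  have h : s ∩ t ∩ (s' ∩ t') = s ∩ s' ∩ (t ∩ t') := Set.inter_inter_inter_comm s t s' t'
  rw [h] at hne ⊢
  exact ⟨s ∩ s', hS s hs s' hs' hne.left, t ∩ t', hT t ht t' ht' hne.right, rfl⟩

section

variable {Ω E : Type*} [NormedAddCommGroup E] [NormedSpace ℝ E]
  {m₁ m₂ mΩ : MeasurableSpace Ω} {μ : Measure Ω} {f g : Ω → E}

/-- If `f` is `m₁`-measurable and `t` belongs to a σ-algebra independent of `m₁`, then `t` factors
out of the integral of `f` over `s ∩ t` for every `m₁`-measurable set `s`. -/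
theorem ProbabilityTheory.Indep.setIntegral_inter_eq_smul (hle₁ : m₁ ≤ mΩ) (hle₂ : m₂ ≤ mΩ)
    (hindep : Indep m₁ m₂ μ) (hf : StronglyMeasurable[m₁] f) {s t : Set Ω}
    (hs : MeasurableSet[m₁] s) (ht : MeasurableSet[m₂] t) :
    ∫ ω in s ∩ t, f ω ∂μ = μ.real t • ∫ ω in s, f ω ∂μ := by
  have hid : Measurable[mΩ, m₁] id := measurable_id'' hle₁
  have hindep' : Indep m₂ (m₁.comap id) μ := by
    rw [MeasurableSpace.comap_id]
    exact hindep.symm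
  rw [Set.inter_comm, ← setIntegral_indicator (hle₁ s hs), ← integral_indicator (hle₁ s hs)]
  exact Indep.setIntegral_eq_smul (m𝓧 := m₁) hle₂ hindep'
    (@Measurable.aemeasurable Ω Ω mΩ m₁ id μ hid) ht ⟨_, hf.indicator hs, .rfl⟩

/-- Two integrable functions with equal integrals on a π-system containing the whole space
have equal integrals on all sets of the generated σ-algebra. -/
theorem MeasureTheory.setIntegral_eq_of_isPiSystem {m : MeasurableSpace Ω} (hm : m ≤ mΩ)
    {S : Set (Set Ω)} (hgen : m = MeasurableSpace.generateFrom S) (hS : IsPiSystem S)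
    (huniv : Set.univ ∈ S) (hf : Integrable f μ) (hg : Integrable g μ)
    (h : ∀ s ∈ S, ∫ ω in s, f ω ∂μ = ∫ ω in s, g ω ∂μ) {s : Set Ω} (hs : MeasurableSet[m] s) :
    ∫ ω in s, f ω ∂μ = ∫ ω in s, g ω ∂μ := by
  induction s, hs using MeasurableSpace.induction_on_inter hgen hS with
  | empty => simp
  | basic s hs => exact h s hs
  | compl s hs ih =>
    rw [setIntegral_compl (hm s hs) hf, setIntegral_compl (hm s hs) hg, ih]
    simpa using h _ huniv
  | iUnion u hu hum ih =>
    rw [integral_iUnion (fun i ↦ hm _ (hum i)) hu hf.integrableOn,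
      integral_iUnion (fun i ↦ hm _ (hum i)) hu hg.integrableOn]
    simp_rw [ih]

/-- If `f` is `m₁`-measurable and `m₂` is independent of `m₁`, then adding `m₂` to a
sub-σ-algebra `m` of `m₁` does not change the conditional expectation of `f`. -/
theorem MeasureTheory.condExp_sup_of_indep [CompleteSpace E] [IsFiniteMeasure μ]
    {m : MeasurableSpace Ω} (hle : m ≤ m₁) (hle₁ : m₁ ≤ mΩ) (hle₂ : m₂ ≤ mΩ)
    (hindep : Indep m₁ m₂ μ) (hf : StronglyMeasurable[m₁] f) :
    μ[f | m ⊔ m₂] =ᵐ[μ] μ[f | m] := by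
  by_cases hfint : Integrable f μ
  swap; · rw [condExp_of_not_integrable hfint, condExp_of_not_integrable hfint]
  have hm : m ≤ mΩ := hle.trans hle₁
  have hsup : m ⊔ m₂ ≤ mΩ := sup_le hm hle₂
  refine (ae_eq_condExp_of_forall_setIntegral_eq hsup hfint
    (fun _ _ _ ↦ integrable_condExp.integrableOn) (fun s hs _ ↦ ?_)
    (stronglyMeasurable_condExp.mono le_sup_left).aestronglyMeasurable).symm
  refine setIntegral_eq_of_isPiSystem hsup (MeasurableSpace.generateFrom_image2_inter m m₂).symm
    (isPiSystem_image2_inter (@MeasurableSpace.isPiSystem_measurableSet _ m)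
      (@MeasurableSpace.isPiSystem_measurableSet _ m₂))
    ⟨Set.univ, MeasurableSet.univ, Set.univ, MeasurableSet.univ, Set.univ_inter _⟩
    integrable_condExp hfint ?_ hs
  rintro _ ⟨s, hs, t, ht, rfl⟩
  rw [hindep.setIntegral_inter_eq_smul hle₁ hle₂ (stronglyMeasurable_condExp.mono hle)
      (hle s hs) ht,
    hindep.setIntegral_inter_eq_smul hle₁ hle₂ hf (hle s hs) ht, setIntegral_condExp hm hfint hs]

end

/-- Conditioning on additional information that is independent of `W` does not change conditional
expectations of functions of `W`: if `W` and `Z` are independent and `g` is measurable, then for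
every bounded measurable `φ : α → ℝ`,
`E[φ(W) | σ(g ∘ W) ⊔ σ(Z)] = E[φ(W) | σ(g ∘ W)]` almost surely. -/
theorem condexp_comap_sup_indep
    {Ω α β γ : Type*} [MeasurableSpace Ω]
    [MeasurableSpace α] [StandardBorelSpace α]
    [MeasurableSpace β] [StandardBorelSpace β]
    [MeasurableSpace γ] [StandardBorelSpace γ]
    (P : Measure Ω) [IsProbabilityMeasure P]
    (W : Ω → α) (Z : Ω → β) (hW : Measurable W) (hZ : Measurable Z)
    (hWZ : IndepFun W Z P)
    (g : α → γ) (hg : Measurable g)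
    (φ : α → ℝ) (hφ : Measurable φ) (hbd : ∃ C, ∀ a, |φ a| ≤ C) :
    P[(fun ω => φ (W ω)) |
        (MeasurableSpace.comap (fun ω => g (W ω)) inferInstance
          ⊔ MeasurableSpace.comap Z inferInstance)]
      =ᵐ[P] P[(fun ω => φ (W ω)) | MeasurableSpace.comap (fun ω => g (W ω)) inferInstance] := by
  exact condExp_sup_of_indep (hg.comp (comap_measurable W)).comap_le hW.comap_le hZ.comap_le hWZ
    (hφ.comp (comap_measurable W)).stronglyMeasurable
end
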